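/- The sequence of quotients a_𝓛(n_{i+1})/a_𝓛(n_i) converges to 1 as i → ∞. -/

import Mathlib

noncomputable def L (x : ℝ) : ℝ := Real.pi ^ (1 / (2 * x)) * Real.exp (1 / ((12 * x + 1) * x))
noncomputable def R (x : ℝ) : ℝ := Real.pi ^ (1 / (2 * x)) * Real.exp (1 / (12 * x ^ 2))
noncomputable def P (x : ℝ) : ℝ := x ^ (1 / x)
noncomputable def aF (F : ℝ → ℝ) (x : ℝ) : ℝ := (F x - 1) * x
noncomputable def calL (x : ℝ) : ℝ := L x * P (2 * x)
noncomputable def calR (x : ℝ) : ℝ := R x * P (2 * x)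
noncomputable def p (x : ℝ) : ℝ := P (2 * x)

/-- `sigma n` is the largest positive integer `ℓ` with `n + (ℓ - 1) ≤ e * (n!)^(1/n)`. -/
noncomputable def sigma (n : ℕ) : ℕ :=
  sSup {ℓ : ℕ | 0 < ℓ ∧ (n : ℝ) + ((ℓ : ℝ) - 1) ≤ Real.exp 1 * (n.factorial : ℝ) ^ ((1 : ℝ) / n)}

/-- `nSeq i` is the `i`-th term (1-indexed) of the increasing enumeration of the set of
positive integers `n` with `sigma (n+1) = sigma n + 1`. -/
noncomputable def nSeq (i : ℕ) : ℕ :=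
  Nat.nth (fun n => 0 < n ∧ sigma (n + 1) = sigma n + 1) (i - 1)

open Filter Topology

lemma sigma_eq_floor (n : ℕ) :
    sigma n = ⌊Real.exp 1 * (n.factorial : ℝ) ^ ((1 : ℝ) / n) - n + 1⌋₊ := by
  set y := Real.exp 1 * (n.factorial : ℝ) ^ ((1 : ℝ) / n) with hy
  have hmem : ∀ l : ℕ, l ∈ {l : ℕ | 0 < l ∧ (n : ℝ) + ((l : ℝ) - 1) ≤ y} ↔
      0 < l ∧ l ≤ ⌊y - n + 1⌋₊ := fun l => by
    refine and_congr_right fun hl => ?_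
    rw [Nat.le_floor_iff' hl.ne']
    constructor <;> intro h <;> linarith
  unfold sigma
  rw [← hy]
  rcases Nat.eq_zero_or_pos ⌊y - n + 1⌋₊ with h0 | h0
  · rw [h0] at hmem ⊢
    rw [Set.eq_empty_of_forall_notMem (s := {l : ℕ | 0 < l ∧ (n : ℝ) + ((l : ℝ) - 1) ≤ y})
      (fun l hl => by have := (hmem l).1 hl; omega)]
    exact csSup_empty
  · exact IsGreatest.csSup_eq ⟨(hmem _).2 ⟨h0, le_rfl⟩, fun l hl => ((hmem l).1 hl).2⟩

/-- If `w n = log n / 2 + c + o(1)`, then `n (exp (w n / n) - 1)` has the same expansion. -/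
lemma tendsto_mul_exp_div_sub_one {w : ℕ → ℝ} {c : ℝ}
    (hw : Tendsto (fun n : ℕ => w n - 1 / 2 * Real.log n) atTop (𝓝 c)) :
    Tendsto (fun n : ℕ => n * (Real.exp (w n / n) - 1) - 1 / 2 * Real.log n) atTop (𝓝 c) := by
  have hinv : Tendsto (fun n : ℕ => (√(n : ℝ))⁻¹) atTop (𝓝 0) :=
    (Real.tendsto_sqrt_atTop.comp tendsto_natCast_atTop_atTop).inv_tendsto_atTop
  have hlog : Tendsto (fun n : ℕ => Real.log n * (√(n : ℝ))⁻¹) atTop (𝓝 0) := by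
    have := ((isLittleO_log_rpow_atTop (r := 1 / 2) (by norm_num)).tendsto_div_nhds_zero).comp
      tendsto_natCast_atTop_atTop
    refine this.congr fun n => ?_
    simp [Real.sqrt_eq_rpow, div_eq_mul_inv]
  have hroot : Tendsto (fun n : ℕ => w n * (√(n : ℝ))⁻¹) atTop (𝓝 0) := by
    have := (hw.mul hinv).add (hlog.const_mul (1 / 2))
    simp only [mul_zero, add_zero] at this
    exact this.congr fun n => by ring
  have hsq : Tendsto (fun n : ℕ => (w n * (√(n : ℝ))⁻¹) ^ 2) atTop (𝓝 0) := by
    simpa using hroot.pow 2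
  have hdiv : Tendsto (fun n : ℕ => w n * (√(n : ℝ))⁻¹ * (√(n : ℝ))⁻¹) atTop (𝓝 0) := by
    simpa using hroot.mul hinv
  have herr : Tendsto (fun n : ℕ => n * (Real.exp (w n / n) - 1) - w n) atTop (𝓝 0) := by
    refine squeeze_zero_norm' ?_ hsq
    filter_upwards [eventually_gt_atTop 0, hdiv.abs.eventually_le_const (by simp : |(0 : ℝ)| < 1)]
      with n hn hsmall
    have hn' : (0 : ℝ) < n := by exact_mod_cast hn
    have hs : (√(n : ℝ)) ^ 2 = n := Real.sq_sqrt hn'.le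
    have hdiv_eq : w n * (√(n : ℝ))⁻¹ * (√(n : ℝ))⁻¹ = w n / n := by
      rw [mul_assoc, ← mul_inv, ← sq, hs, div_eq_mul_inv]
    rw [hdiv_eq] at hsmall
    have hexp := Real.abs_exp_sub_one_sub_id_le hsmall
    have heq : n * (Real.exp (w n / n) - 1) - w n
        = n * (Real.exp (w n / n) - 1 - w n / n) := by field_simp
    rw [heq, Real.norm_eq_abs, abs_mul, abs_of_pos hn']
    calc (n : ℝ) * |Real.exp (w n / n) - 1 - w n / n| ≤ n * (w n / n) ^ 2 := by gcongr
      _ = (w n * (√(n : ℝ))⁻¹) ^ 2 := by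
        rw [mul_pow, inv_pow, hs]; field_simp
  simpa using herr.add hw

lemma exp_one_mul_factorial_rpow {n : ℕ} (hn : 0 < n) :
    Real.exp 1 * (n.factorial : ℝ) ^ ((1 : ℝ) / n)
      = n * Real.exp ((Real.log (Stirling.stirlingSeq n) + 1 / 2 * Real.log (2 * n)) / n) := by
  have hn' : (0 : ℝ) < n := by exact_mod_cast hn
  have hlog := Stirling.log_stirlingSeq_formula n
  rw [Real.log_div hn'.ne' (Real.exp_pos 1).ne', Real.log_exp] at hlog
  rw [Real.rpow_def_of_pos (by exact_mod_cast n.factorial_pos), ← Real.exp_add, hlog]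
  nth_rewrite 2 [← Real.exp_log hn']
  rw [← Real.exp_add]
  congr 1
  field_simp
  ring

lemma tendsto_exp_one_mul_factorial_rpow_sub :
    Tendsto (fun n : ℕ => Real.exp 1 * (n.factorial : ℝ) ^ ((1 : ℝ) / n) - n
      - 1 / 2 * Real.log n) atTop (𝓝 (Real.log √Real.pi + 1 / 2 * Real.log 2)) := by
  have hs : Tendsto (fun n => Real.log (Stirling.stirlingSeq n)) atTop (𝓝 (Real.log √Real.pi)) :=
    Stirling.tendsto_stirlingSeq_sqrt_pi.log (Real.sqrt_pos.2 Real.pi_pos).ne'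
  have hw : Tendsto (fun n : ℕ => (Real.log (Stirling.stirlingSeq n) + 1 / 2 * Real.log (2 * n))
      - 1 / 2 * Real.log n) atTop (𝓝 (Real.log √Real.pi + 1 / 2 * Real.log 2)) := by
    refine (hs.add_const (1 / 2 * Real.log 2)).congr' ?_
    filter_upwards [eventually_gt_atTop 0] with n hn
    rw [Real.log_mul two_ne_zero (by positivity)]
    ring
  refine (tendsto_mul_exp_div_sub_one hw).congr' ?_
  filter_upwards [eventually_gt_atTop 0] with n hn
  rw [exp_one_mul_factorial_rpow hn]
  ring

lemma calL_eq_exp {x : ℝ} (hx : 0 < x) :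
    calL x = Real.exp ((1 / 2 * Real.log Real.pi + 1 / 2 * Real.log (2 * x) + 1 / (12 * x + 1))
      / x) := by
  unfold calL L P
  rw [Real.rpow_def_of_pos Real.pi_pos, Real.rpow_def_of_pos (by positivity : 0 < 2 * x),
    ← Real.exp_add, ← Real.exp_add]
  congr 1
  field_simp
  ring

lemma tendsto_aF_calL_sub_log :
    Tendsto (fun n : ℕ => aF calL n - 1 / 2 * Real.log n) atTop
      (𝓝 (1 / 2 * Real.log Real.pi + 1 / 2 * Real.log 2)) := by
  have hinv : Tendsto (fun n : ℕ => 1 / (12 * (n : ℝ) + 1)) atTop (𝓝 0) := by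
    simp only [one_div]
    exact (tendsto_atTop_add_const_right _ _
      (tendsto_natCast_atTop_atTop.const_mul_atTop (by norm_num : (0 : ℝ) < 12))).inv_tendsto_atTop
  have hw : Tendsto (fun n : ℕ => (1 / 2 * Real.log Real.pi + 1 / 2 * Real.log (2 * n)
      + 1 / (12 * (n : ℝ) + 1)) - 1 / 2 * Real.log n) atTop
      (𝓝 (1 / 2 * Real.log Real.pi + 1 / 2 * Real.log 2)) := by
    have := hinv.const_add (1 / 2 * Real.log Real.pi + 1 / 2 * Real.log 2)
    rw [add_zero] at this
    refine this.congr' ?_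
    filter_upwards [eventually_gt_atTop 0] with n hn
    rw [Real.log_mul two_ne_zero (by positivity)]
    ring
  refine (tendsto_mul_exp_div_sub_one hw).congr' ?_
  filter_upwards [eventually_gt_atTop 0] with n hn
  rw [aF, calL_eq_exp (by exact_mod_cast hn)]
  ring

lemma eventually_sigma_succ_le : ∀ᶠ n in atTop, sigma (n + 1) ≤ sigma n + 1 := by
  have h := tendsto_exp_one_mul_factorial_rpow_sub
  set g : ℕ → ℝ := fun n => Real.exp 1 * (n.factorial : ℝ) ^ ((1 : ℝ) / n) - n
  have hd := ((h.comp (tendsto_add_atTop_nat 1)).sub h).eventually_lt_const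
    (by rw [sub_self]; norm_num : _ < (1 / 2 : ℝ))
  filter_upwards [hd, eventually_gt_atTop 0] with n hn hpos
  have hn' : (0 : ℝ) < n := by exact_mod_cast hpos
  have hlog : Real.log ((n + 1 : ℕ) : ℝ) ≤ Real.log n + 1 := by
    have hle : ((n + 1 : ℕ) : ℝ) ≤ n * Real.exp 1 := by
      have h1 : (1 : ℝ) ≤ n := by exact_mod_cast hpos
      have h2 := Real.add_one_le_exp (1 : ℝ)
      push_cast
      nlinarith
    calc Real.log ((n + 1 : ℕ) : ℝ) ≤ Real.log (n * Real.exp 1) :=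
          Real.log_le_log (by positivity) hle
      _ = Real.log n + 1 := by rw [Real.log_mul hn'.ne' (Real.exp_pos 1).ne', Real.log_exp]
  simp only [Function.comp] at hn
  rw [sigma_eq_floor, sigma_eq_floor]
  change ⌊g (n + 1) + 1⌋₊ ≤ ⌊g n + 1⌋₊ + 1
  refine Nat.lt_succ_iff.1 (Nat.floor_lt' (Nat.succ_ne_zero _) |>.2 ?_)
  have := Nat.lt_floor_add_one (g n + 1)
  change g (n + 1) - _ - (g n - _) < _ at hn
  push_cast at *
  linarith

lemma eventually_sigma_lt_sigma_mul : ∀ᶠ n in atTop, sigma n < sigma (100 * n) := by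
  have h := tendsto_exp_one_mul_factorial_rpow_sub
  set g : ℕ → ℝ := fun n => Real.exp 1 * (n.factorial : ℝ) ^ ((1 : ℝ) / n) - n
  have hmul : Tendsto (fun n : ℕ => 100 * n) atTop atTop :=
    tendsto_id.const_mul_atTop' (by norm_num)
  have hd := ((h.comp hmul).sub h).eventually_const_lt
    (by rw [sub_self]; norm_num : (-1 / 2 : ℝ) < _)
  have hgpos : ∀ᶠ n in atTop, -1 ≤ g n := by
    have hlog : Tendsto (fun n : ℕ => 1 / 2 * Real.log n) atTop atTop :=
      (Real.tendsto_log_atTop.comp tendsto_natCast_atTop_atTop).const_mul_atTop (by norm_num)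
    filter_upwards [(h.add_atTop hlog).eventually_ge_atTop (-1)] with n hn
    linarith
  have hlog100 : 3 ≤ Real.log 100 := by
    rw [Real.le_log_iff_exp_le (by norm_num)]
    have h1 := Real.exp_one_lt_d9
    calc Real.exp 3 = Real.exp 1 ^ 3 := by rw [← Real.exp_nat_mul]; norm_num
      _ ≤ 3 ^ 3 := by gcongr; linarith
      _ ≤ 100 := by norm_num
  filter_upwards [hd, hgpos, eventually_gt_atTop 0] with n hn hgn hpos
  have hn' : (0 : ℝ) < n := by exact_mod_cast hpos
  simp only [Function.comp] at hn
  change _ < g (100 * n) - _ - (g n - _) at hn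
  rw [Nat.cast_mul, Nat.cast_ofNat, Real.log_mul (by norm_num) hn'.ne'] at hn
  rw [sigma_eq_floor, sigma_eq_floor]
  change ⌊g n + 1⌋₊ < ⌊g (100 * n) + 1⌋₊
  refine Nat.lt_of_succ_le (Nat.le_floor ?_)
  have := Nat.floor_le (by linarith : 0 ≤ g n + 1)
  push_cast
  linarith

/-- Past some point, every `n` is followed by a jump of `sigma` before `200 * n`. -/
lemma eventually_exists_sigma_jump :
    ∀ᶠ n in atTop, ∃ k, n < k ∧ k ≤ 200 * n ∧ sigma (k + 1) = sigma k + 1 := by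
  obtain ⟨N, hN⟩ := eventually_atTop.1 (eventually_sigma_succ_le.and eventually_sigma_lt_sigma_mul)
  filter_upwards [eventually_ge_atTop N, eventually_gt_atTop 0] with n hn hpos
  have hex : ∃ d, sigma (n + 1) < sigma (n + 1 + d) :=
    ⟨99 * (n + 1), by
      have := (hN (n + 1) (by omega)).2
      rwa [show n + 1 + 99 * (n + 1) = 100 * (n + 1) by ring]⟩
  classical
  have hspec := Nat.find_spec hex
  have hmin : ∀ d < Nat.find hex, sigma (n + 1 + d) ≤ sigma (n + 1) :=
    fun d hd => not_lt.1 (Nat.find_min hex hd)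
  have hle : Nat.find hex ≤ 99 * (n + 1) := Nat.find_min' hex <| by
    have := (hN (n + 1) (by omega)).2
    rwa [show n + 1 + 99 * (n + 1) = 100 * (n + 1) by ring]
  rcases hfind : Nat.find hex with _ | d
  · rw [hfind] at hspec
    exact absurd hspec (by simp)
  · rw [hfind] at hspec hmin hle
    refine ⟨n + 1 + d, by omega, by omega, ?_⟩
    have h1 := hmin d (Nat.lt_succ_self d)
    have h2 := (hN (n + 1 + d) (by omega)).1
    rw [← add_assoc] at hspec
    omega

lemma infinite_sigma_jumps : {n | 0 < n ∧ sigma (n + 1) = sigma n + 1}.Infinite := by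
  refine Set.infinite_of_not_bddAbove fun ⟨b, hb⟩ => ?_
  obtain ⟨n, ⟨k, hk, -, hjump⟩, hn⟩ :=
    (eventually_exists_sigma_jump.and (eventually_ge_atTop b)).exists
  have : k ≤ b := hb ⟨by omega, hjump⟩
  omega

lemma tendsto_nSeq_atTop : Tendsto nSeq atTop atTop :=
  (Nat.nth_strictMono infinite_sigma_jumps).tendsto_atTop.comp (tendsto_sub_atTop_nat 1)

lemma eventually_nSeq_succ_le : ∀ᶠ i in atTop, nSeq (i + 1) ≤ 200 * nSeq i := by
  filter_upwards [tendsto_nSeq_atTop.eventually eventually_exists_sigma_jump] with i hi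
  obtain ⟨k, hlt, hle, hjump⟩ := hi
  classical
  have hcount := Nat.nth_count (p := fun n => 0 < n ∧ sigma (n + 1) = sigma n + 1)
    (n := k) ⟨by omega, hjump⟩
  refine le_trans ?_ hle
  unfold nSeq at hlt ⊢
  rw [← hcount] at hlt ⊢
  rw [Nat.nth_lt_nth infinite_sigma_jumps] at hlt
  rw [Nat.nth_le_nth infinite_sigma_jumps]
  omega

theorem stmt12 :
    Filter.Tendsto (fun i : ℕ => aF calL (nSeq (i + 1)) / aF calL (nSeq i))
      Filter.atTop (nhds 1) := by
  have hf := tendsto_aF_calL_sub_log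
  have hfn := hf.comp tendsto_nSeq_atTop
  have hlog : Tendsto (fun i => 1 / 2 * Real.log (nSeq i)) atTop atTop :=
    (Real.tendsto_log_atTop.comp
      (tendsto_natCast_atTop_atTop.comp tendsto_nSeq_atTop)).const_mul_atTop (by norm_num)
  have htop : Tendsto (fun i => aF calL (nSeq i)) atTop atTop :=
    (hfn.add_atTop hlog).congr fun i => by simp
  have hdiff := (hfn.comp (tendsto_add_atTop_nat 1)).sub hfn
  rw [sub_self] at hdiff
  have hmono : Monotone nSeq := fun i j hij =>
    (Nat.nth_strictMono infinite_sigma_jumps).monotone (Nat.sub_le_sub_right hij 1)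
  have hbound : ∀ᶠ i in atTop,
      ‖aF calL (nSeq (i + 1)) - aF calL (nSeq i)‖ ≤ 1 + 1 / 2 * Real.log 200 := by
    filter_upwards [hdiff.abs.eventually_le_const (by simp : |(0 : ℝ)| < 1),
      eventually_nSeq_succ_le, tendsto_nSeq_atTop.eventually_gt_atTop 0] with i hi hle hpos
    have hpos' : (0 : ℝ) < nSeq i := by exact_mod_cast hpos
    have hlow : Real.log (nSeq i) ≤ Real.log (nSeq (i + 1)) :=
      Real.log_le_log hpos' (by exact_mod_cast hmono i.le_succ)
    have hup : Real.log (nSeq (i + 1)) ≤ Real.log 200 + Real.log (nSeq i) := by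
      rw [← Real.log_mul (by norm_num) hpos'.ne']
      exact Real.log_le_log (hpos'.trans_le (by exact_mod_cast hmono i.le_succ))
        (by exact_mod_cast hle)
    simp only [Function.comp] at hi
    rw [Real.norm_eq_abs]
    rw [abs_le] at hi ⊢
    constructor <;> linarith [hi.1, hi.2]
  have hquot : Tendsto (fun i => (aF calL (nSeq (i + 1)) - aF calL (nSeq i))
      / aF calL (nSeq i)) atTop (𝓝 0) := by
    simp only [div_eq_mul_inv]
    exact isBoundedUnder_le_mul_tendsto_zero (isBoundedUnder_of_eventually_le hbound)
      htop.inv_tendsto_atTop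
  have hone := hquot.add_const 1
  rw [zero_add] at hone
  refine hone.congr' ?_
  filter_upwards [htop.eventually_gt_atTop 0] with i hi
  field_simp
  ring
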